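/- (Lemma 3.1, Gaussian two-point estimate.) Let β, γ > 0, u, v > 0, and let λ satisfy 0 < λ < 1 − γ/β². For c ∈ [−1,1), let κ_± = √(2(1±c)), let Z̄_1, Z̄_2 be independent standard normal random variables, and set U_1 = (κ_+ Z̄_1 + κ_− Z̄_2)/2 and U_2 = (κ_+ Z̄_1 − κ_− Z̄_2)/2, so that U_1, U_2 are standard normal with covariance c. With g(x) = log(1+x), define Ξ_N(c) = u v β² N e^{−2γN} · E[ exp( β√N(U_1+U_2) − 2g(u e^{β√N U_1 − γN}) − 2g(v e^{β√N U_2 − γN}) ) ]. Then there exist constants C = C(γ,β,u,v,λ) and C' = C'(γ,β,u,v), independent of N and c, such that for all N: if c > γ/β² + λ − 1 then Ξ_N(c) ≤ C (1−c)^{−1/2} exp( − γ²N / (β²(1+c)) ), and if c ≤ γ/β² + λ − 1 then Ξ_N(c) ≤ C' N exp( N(β²(1+c) − 2γ) ). -/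

import Mathlib

open MeasureTheory ProbabilityTheory Real

noncomputable section

/-- `g(x) = log(1+x)`. -/
def gfun (x : ℝ) : ℝ := Real.log (1 + x)

/-- `Ξ_N(c)` of Lemma 3.1: `uvβ²N e^{-2γN} E[exp(β√N(U₁+U₂) − 2g(u e^{β√N U₁−γN})
− 2g(v e^{β√N U₂−γN}))]`, where the covariance-`c` standard normal pair `(U₁,U₂)` is
realized as `U₁ = (κ₊ Z̄₁ + κ₋ Z̄₂)/2`, `U₂ = (κ₊ Z̄₁ − κ₋ Z̄₂)/2` with `κ_± = √(2(1±c))`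
and `Z̄₁, Z̄₂` independent standard normals. -/
def Xi (β γ u v : ℝ) (N : ℕ) (c : ℝ) : ℝ :=
  u * v * β ^ 2 * N * Real.exp (-(2 * γ * N)) *
    ∫ z : ℝ × ℝ,
      Real.exp (β * Real.sqrt N *
          ((Real.sqrt (2 * (1 + c)) * z.1 + Real.sqrt (2 * (1 - c)) * z.2) / 2 +
            (Real.sqrt (2 * (1 + c)) * z.1 - Real.sqrt (2 * (1 - c)) * z.2) / 2) -
        2 * gfun (u * Real.exp (β * Real.sqrt N *
          ((Real.sqrt (2 * (1 + c)) * z.1 + Real.sqrt (2 * (1 - c)) * z.2) / 2) - γ * N)) -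
        2 * gfun (v * Real.exp (β * Real.sqrt N *
          ((Real.sqrt (2 * (1 + c)) * z.1 - Real.sqrt (2 * (1 - c)) * z.2) / 2) - γ * N)))
      ∂((gaussianReal 0 1).prod (gaussianReal 0 1))

end

theorem integral_exp_neg_mul_abs {k : ℝ} (hk : 0 < k) :
    ∫ x : ℝ, exp (-(k * |x|)) = 2 / k := by
  rw [integral_comp_abs (f := fun x => exp (-(k * x)))]
  simp_rw [← neg_mul]
  rw [integral_exp_mul_Ioi (neg_neg_of_pos hk)]
  simp [div_eq_mul_inv]

theorem integrable_exp_neg_mul_abs {k : ℝ} (hk : 0 < k) :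
    Integrable fun x : ℝ => exp (-(k * |x|)) :=
  .of_integral_ne_zero (by rw [integral_exp_neg_mul_abs hk]; positivity)

/-- A Gaussian average of an exponentially localized function of an affine image of the variable:
the localization absorbs the tilt `m / b ^ 2` of the Gaussian density near `m / b`. -/
theorem integral_exp_neg_mul_abs_gaussianReal_le {k b m l : ℝ} (hb : 0 < b) (hm : 0 ≤ m)
    (hk : m / b ^ 2 < k) :
    ∫ z, exp (-(k * |b * z - m + l|)) ∂(gaussianReal 0 1) ≤
      exp (-(m ^ 2 / (2 * b ^ 2)) + m / b ^ 2 * l) * (2 / ((k - m / b ^ 2) * b)) := by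
  have hkr : 0 < k - m / b ^ 2 := sub_pos.2 hk
  have hint : Integrable fun z : ℝ => exp (-((k - m / b ^ 2) * |b * z - m + l|)) := by
    have h := (((integrable_exp_neg_mul_abs hkr).comp_add_right (-m + l)).comp_mul_left' hb.ne')
    refine h.congr (.of_forall fun z => ?_)
    simp only [sub_eq_add_neg, add_assoc]
  have hval : ∫ z : ℝ, exp (-((k - m / b ^ 2) * |b * z - m + l|)) = 2 / ((k - m / b ^ 2) * b) := by
    have h1 := Measure.integral_comp_mul_left
      (fun x : ℝ => exp (-((k - m / b ^ 2) * |x + (-m + l)|))) b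
    rw [integral_add_right_eq_self (fun x : ℝ => exp (-((k - m / b ^ 2) * |x|))),
      integral_exp_neg_mul_abs hkr, abs_of_pos (inv_pos.2 hb), smul_eq_mul] at h1
    simp only [sub_eq_add_neg, add_assoc] at h1 ⊢
    rw [h1]
    field_simp
  rw [integral_gaussianReal_eq_integral_smul one_ne_zero, ← hval, ← integral_const_mul]
  refine integral_mono_of_nonneg
    (.of_forall fun z => smul_nonneg (gaussianPDFReal_nonneg _ _ _) (exp_pos _).le)
    (hint.const_mul _) (.of_forall fun z => ?_)
  have hpi : (√(2 * π))⁻¹ ≤ 1 := by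
    refine inv_le_one_of_one_le₀ (one_le_sqrt.2 ?_)
    linarith [pi_gt_three]
  have hpdf : gaussianPDFReal 0 1 z ≤ exp (-(z ^ 2 / 2)) := by
    simp only [gaussianPDFReal, NNReal.coe_one, mul_one, sub_zero]
    calc _ ≤ 1 * exp (-z ^ 2 / 2) := by gcongr
      _ = _ := by rw [one_mul, neg_div]
  simp only [smul_eq_mul]
  calc gaussianPDFReal 0 1 z * exp (-(k * |b * z - m + l|))
      ≤ exp (-(z ^ 2 / 2)) * exp (-(k * |b * z - m + l|)) := by gcongr
    _ ≤ _ := by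
      rw [← exp_add, ← exp_add, exp_le_exp]
      have hs : -|b * z - m + l| ≤ b * z - m + l := neg_abs_le _
      have hr : 0 ≤ m / b ^ 2 := by positivity
      have hsq : m / b ^ 2 * (b * z - m) + m ^ 2 / (2 * b ^ 2) ≤ z ^ 2 / 2 := by
        have : z ^ 2 / 2 - (m / b ^ 2 * (b * z - m) + m ^ 2 / (2 * b ^ 2)) =
            (z - m / b) ^ 2 / 2 := by
          field_simp
          ring
        nlinarith [sq_nonneg (z - m / b)]
      nlinarith [mul_le_mul_of_nonneg_left hs hr]

theorem gfun_exp_nonneg (t : ℝ) : 0 ≤ gfun (exp t) :=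
  log_nonneg (by linarith [exp_pos t])

theorem le_gfun_exp (t : ℝ) : t ≤ gfun (exp t) :=
  (le_log_iff_exp_le (by positivity)).2 (by linarith)

theorem sub_two_mul_gfun_exp_le (t : ℝ) : t - 2 * gfun (exp t) ≤ -|t| := by
  have h0 := gfun_exp_nonneg t
  have h1 := le_gfun_exp t
  rcases abs_cases t with ⟨h, _⟩ | ⟨h, _⟩ <;> linarith

theorem mul_abs_add_add_mul_abs_sub_le {θ : ℝ} (h0 : 0 ≤ θ) (h1 : θ ≤ 1) (s t : ℝ) :
    θ * |s + t| + (1 - θ) * |s - t| ≤ |s| + |t| := by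
  nlinarith [mul_le_mul_of_nonneg_left (abs_add_le s t) h0,
    mul_le_mul_of_nonneg_left (abs_sub s t) (sub_nonneg.2 h1)]

/-- Dropping the nonnegative `gfun` terms bounds `Xi` by a Gaussian exponential moment. -/
theorem Xi_le_exp_moment {β γ u v : ℝ} (hu : 0 < u) (hv : 0 < v) (N : ℕ) {c : ℝ}
    (hc : -1 ≤ c) :
    Xi β γ u v N c ≤ u * v * β ^ 2 * N * exp (N * (β ^ 2 * (1 + c) - 2 * γ)) := by
  have hg : ∀ w x : ℝ, 0 < w → 0 ≤ gfun (w * exp x) := fun w x hw =>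
    log_nonneg (by have := mul_pos hw (exp_pos x); linarith)
  set b := β * √N * √(2 * (1 + c)) with hb
  have hb2 : b ^ 2 / 2 = N * (β ^ 2 * (1 + c)) := by
    rw [hb, mul_pow, mul_pow, sq_sqrt (by positivity), sq_sqrt (by linarith)]
    ring
  have hval : ∫ z : ℝ × ℝ, exp (b * z.1) ∂((gaussianReal 0 1).prod (gaussianReal 0 1)) =
      exp (N * (β ^ 2 * (1 + c))) := by
    have h := integral_prod_mul (μ := gaussianReal 0 1) (ν := gaussianReal 0 1)
      (fun x : ℝ => exp (b * x)) (fun _ : ℝ => (1 : ℝ))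
    have hmgf := congrFun (mgf_id_gaussianReal (μ := 0) (v := 1)) b
    simp only [mgf, id] at hmgf
    simp only [mul_one] at h
    rw [h, hmgf, ← hb2]
    simp
  have hint : Integrable (fun z : ℝ × ℝ => exp (b * z.1))
      ((gaussianReal 0 1).prod (gaussianReal 0 1)) :=
    .of_integral_ne_zero (by rw [hval]; positivity)
  rw [show exp (N * (β ^ 2 * (1 + c) - 2 * γ)) =
    exp (-(2 * γ * N)) * exp (N * (β ^ 2 * (1 + c))) by rw [← exp_add]; ring_nf, ← mul_assoc,
    ← hval, Xi]
  refine mul_le_mul_of_nonneg_left ?_ (by positivity)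
  refine integral_mono_of_nonneg (.of_forall fun z => (exp_pos _).le) hint (.of_forall fun z => ?_)
  refine exp_le_exp.2 ?_
  have h1 := hg u (β * √N * ((√(2 * (1 + c)) * z.1 + √(2 * (1 - c)) * z.2) / 2) - γ * N) hu
  have h2 := hg v (β * √N * ((√(2 * (1 + c)) * z.1 - √(2 * (1 - c)) * z.2) / 2) - γ * N) hv
  rw [hb]
  linarith

/-- The average defining `Xi` is dominated by a product of two one-dimensional Gaussian averages,
one in the sum and one in the difference of the two Gaussians. -/
theorem Xi_le_mul_integral {β γ u v θ : ℝ} (hu : 0 < u) (hv : 0 < v) (h0 : 0 ≤ θ) (h1 : θ ≤ 1)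
    (N : ℕ) (c : ℝ) :
    Xi β γ u v N c ≤ β ^ 2 * N *
      ((∫ z, exp (-(θ * |β * √N * √(2 * (1 + c)) * z - 2 * γ * N + (log u + log v)|))
          ∂(gaussianReal 0 1)) *
        ∫ z, exp (-((1 - θ) * |β * √N * √(2 * (1 - c)) * z - 0 + (log u - log v)|))
          ∂(gaussianReal 0 1)) := by
  have hI : ∀ k b m l : ℝ, 0 ≤ k →
      Integrable (fun z => exp (-(k * |b * z - m + l|))) (gaussianReal 0 1) := by
    intro k b m l hk
    refine .of_bound (by fun_prop) 1 (.of_forall fun z => ?_)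
    rw [norm_eq_abs, abs_exp, exp_le_one_iff]
    have := mul_nonneg hk (abs_nonneg (b * z - m + l))
    linarith
  rw [← integral_prod_mul, Xi]
  have hassoc : ∀ I : ℝ, u * v * β ^ 2 * N * exp (-(2 * γ * N)) * I =
      β ^ 2 * N * (u * v * exp (-(2 * γ * N)) * I) := fun I => by ring
  rw [hassoc, ← integral_const_mul]
  refine mul_le_mul_of_nonneg_left ?_ (by positivity)
  refine integral_mono_of_nonneg (.of_forall fun z => by positivity)
    ((hI _ _ _ _ h0).mul_prod (hI _ _ _ _ (sub_nonneg.2 h1))) (.of_forall fun z => ?_)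
  simp only
  set X := β * √N * ((√(2 * (1 + c)) * z.1 + √(2 * (1 - c)) * z.2) / 2) - γ * N with hX
  set Y := β * √N * ((√(2 * (1 + c)) * z.1 - √(2 * (1 - c)) * z.2) / 2) - γ * N with hY
  have hS : β * √N * √(2 * (1 + c)) * z.1 - 2 * γ * N + (log u + log v) =
      (log u + X) + (log v + Y) := by rw [hX, hY]; ring
  have hD : β * √N * √(2 * (1 - c)) * z.2 - 0 + (log u - log v) =
      (log u + X) - (log v + Y) := by rw [hX, hY]; ring
  have huX : u * exp X = exp (log u + X) := by rw [exp_add, exp_log hu]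
  have hvY : v * exp Y = exp (log v + Y) := by rw [exp_add, exp_log hv]
  have huv : u * v * exp (-(2 * γ * N)) = exp (log u + log v - 2 * γ * N) := by
    rw [sub_eq_add_neg, exp_add, exp_add, exp_log hu, exp_log hv]
  rw [hS, hD, huX, hvY, huv, ← exp_add, ← exp_add, exp_le_exp]
  have e1 := sub_two_mul_gfun_exp_le (log u + X)
  have e2 := sub_two_mul_gfun_exp_le (log v + Y)
  have e3 := mul_abs_add_add_mul_abs_sub_le h0 h1 (log u + X) (log v + Y)
  have e4 : log u + log v - 2 * γ * N +
      β * √N * ((√(2 * (1 + c)) * z.1 + √(2 * (1 - c)) * z.2) / 2 +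
        (√(2 * (1 + c)) * z.1 - √(2 * (1 - c)) * z.2) / 2) = (log u + X) + (log v + Y) := by
    rw [hX, hY]; ring
  linarith

/-- For covariances `c` with `1 + c` above `γ / β ^ 2` by a fixed margin, `Xi` is of the order of
the Gaussian density of the sum at its typical location. -/
theorem Xi_le_of_lt {β γ u v lam : ℝ} (hβ : 0 < β) (hγ : 0 < γ) (hu : 0 < u) (hv : 0 < v)
    (hlam : 0 < lam) (N : ℕ) {c : ℝ} (hc1 : c < 1) (hc : γ / β ^ 2 + lam - 1 < c) :
    Xi β γ u v N c ≤
      8 * exp |log u + log v| /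
          ((1 - γ / (γ + lam * β ^ 2)) ^ 2 * √(γ / β ^ 2 + lam)) *
        (1 - c) ^ (-(1 : ℝ) / 2) * exp (-(γ ^ 2 * N) / (β ^ 2 * (1 + c))) := by
  set ρ := γ / (γ + lam * β ^ 2) with hρ
  set δ := γ / β ^ 2 + lam with hδ
  set l := log u + log v
  have hδ0 : 0 < δ := by positivity
  have hδc : δ < 1 + c := by linarith
  have hρ0 : 0 < ρ := by positivity
  have hρ1 : ρ < 1 := (div_lt_one (by positivity)).2 (by nlinarith [mul_pos hlam (pow_pos hβ 2)])
  have h1c : 0 < 1 - c := by linarith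
  have hpc : 0 < 1 + c := by linarith
  rcases N.eq_zero_or_pos with rfl | hN
  · simp only [Xi, Nat.cast_zero, mul_zero, zero_mul]
    positivity
  have hN0 : (0 : ℝ) < N := by exact_mod_cast hN
  set θ := (1 + ρ) / 2 with hθ
  set bp := β * √N * √(2 * (1 + c)) with hbp
  set bm := β * √N * √(2 * (1 - c)) with hbm
  have hbp0 : 0 < bp := by positivity
  have hbm0 : 0 < bm := by positivity
  have hbp2 : bp ^ 2 = 2 * N * (β ^ 2 * (1 + c)) := by
    rw [hbp, mul_pow, mul_pow, sq_sqrt hN0.le, sq_sqrt (by positivity)]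
    ring
  have hr : 2 * γ * N / bp ^ 2 = γ / (β ^ 2 * (1 + c)) := by
    rw [hbp2]
    field_simp
  have hrρ : γ / (β ^ 2 * (1 + c)) ≤ ρ := by
    rw [hρ]
    refine div_le_div_of_nonneg_left hγ.le (by positivity) ?_
    have : β ^ 2 * δ = γ + lam * β ^ 2 := by rw [hδ]; field_simp
    nlinarith [pow_pos hβ 2]
  have hE : (2 * γ * N) ^ 2 / (2 * bp ^ 2) = γ ^ 2 * N / (β ^ 2 * (1 + c)) := by
    rw [hbp2]
    field_simp
  have hr0 : 0 < γ / (β ^ 2 * (1 + c)) := by positivity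
  have hrl : γ / (β ^ 2 * (1 + c)) * l ≤ |l| := by
    nlinarith [le_abs_self l, abs_nonneg l]
  have hbpl : β * √N * √(2 * δ) ≤ bp := by rw [hbp]; gcongr
  have hp : ∫ z, exp (-(θ * |bp * z - 2 * γ * N + l|)) ∂(gaussianReal 0 1) ≤
      exp (-(γ ^ 2 * N) / (β ^ 2 * (1 + c))) * exp |l| *
        (2 / ((1 - ρ) / 2 * (β * √N * √(2 * δ)))) := by
    refine (integral_exp_neg_mul_abs_gaussianReal_le (l := l) hbp0 (by positivity)
      (by rw [hr]; linarith)).trans ?_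
    rw [hr, hE, ← exp_add, neg_div]
    have : (1 - ρ) / 2 ≤ θ - γ / (β ^ 2 * (1 + c)) := by linarith
    have h2 : 0 < 1 - ρ := by linarith
    have h3 : 0 < θ - γ / (β ^ 2 * (1 + c)) := by linarith
    gcongr
  have hm : ∫ z, exp (-((1 - θ) * |bm * z - 0 + (log u - log v)|)) ∂(gaussianReal 0 1) ≤
      2 / ((1 - ρ) / 2 * bm) := by
    refine (integral_exp_neg_mul_abs_gaussianReal_le hbm0 le_rfl
      (by rw [zero_div]; linarith)).trans (le_of_eq ?_)
    rw [show 1 - θ = (1 - ρ) / 2 by rw [hθ]; ring]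
    simp
  refine (Xi_le_mul_integral hu hv (θ := θ) (by positivity) (by linarith) N c).trans ?_
  calc _ ≤ β ^ 2 * N * ((exp (-(γ ^ 2 * N) / (β ^ 2 * (1 + c))) * exp |l| *
        (2 / ((1 - ρ) / 2 * (β * √N * √(2 * δ))))) * (2 / ((1 - ρ) / 2 * bm))) := by
        have h2 : 0 < 1 - ρ := by linarith
        gcongr
    _ = _ := by
        have h2 : 1 - ρ ≠ 0 := by linarith
        rw [neg_div 2 (1 : ℝ), rpow_neg h1c.le, ← sqrt_eq_rpow, hbm, sqrt_mul zero_le_two,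
          sqrt_mul zero_le_two]
        have a1 : √δ ≠ 0 := by positivity
        have a2 : √(1 - c) ≠ 0 := by positivity
        have a3 : √(N : ℝ) ^ 2 = N := sq_sqrt hN0.le
        have a4 : √(2 : ℝ) ^ 2 = 2 := sq_sqrt zero_le_two
        have a5 : √(N : ℝ) ≠ 0 := by positivity
        generalize exp (-(γ ^ 2 * N) / (β ^ 2 * (1 + c))) = E
        field_simp
        rw [a3, a4]
        ring

/-- Lemma 3.1 (Gaussian two-point estimate): `Ξ_N(c) ≤ Ξ̄_N(c)` with constants independent
of `N` and `c`. -/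
theorem stmt5 (β γ u v lam : ℝ) (hβ : 0 < β) (hγ : 0 < γ) (hu : 0 < u) (hv : 0 < v)
    (hlam : 0 < lam) (hlam' : lam < 1 - γ / β ^ 2) :
    ∃ C C' : ℝ, ∀ N : ℕ, ∀ c ∈ Set.Ico (-1 : ℝ) 1,
      (γ / β ^ 2 + lam - 1 < c →
        Xi β γ u v N c ≤
          C * (1 - c) ^ (-(1 : ℝ) / 2) *
            Real.exp (-(γ ^ 2 * N) / (β ^ 2 * (1 + c)))) ∧
      (c ≤ γ / β ^ 2 + lam - 1 →
        Xi β γ u v N c ≤ C' * N * Real.exp (N * (β ^ 2 * (1 + c) - 2 * γ))) := by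
  exact ⟨8 * exp |log u + log v| /
      ((1 - γ / (γ + lam * β ^ 2)) ^ 2 * √(γ / β ^ 2 + lam)), u * v * β ^ 2,
    fun N c hc => ⟨Xi_le_of_lt hβ hγ hu hv hlam N hc.2, fun _ => Xi_le_exp_moment hu hv N hc.1⟩⟩
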